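/- Let f : ℝ³ → ℝ³ be a smooth compactly supported vector field and g : ℝ³ → ℝ a smooth compactly supported function, and suppose curl f(x) = ∇g(x) for all x ∈ ℝ³, where curl f = (∂f₃/∂x₂ − ∂f₂/∂x₃, ∂f₁/∂x₃ − ∂f₃/∂x₁, ∂f₂/∂x₁ − ∂f₁/∂x₂) and ∇g = (∂g/∂x₁, ∂g/∂x₂, ∂g/∂x₃). Then g is identically zero, and consequently curl f is identically zero. -/

import Mathlib

/-- Partial derivative of `f : ℝ³ → ℝ` in the `i`-th coordinate at `x`. -/
noncomputable def pderiv3 (i : Fin 3) (f : (Fin 3 → ℝ) → ℝ) (x : Fin 3 → ℝ) : ℝ :=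
  deriv (fun y => f (Function.update x i y)) (x i)

/-- The curl of a vector field `w : ℝ³ → ℝ³`:
`curl w = (∂w₃/∂x₂ − ∂w₂/∂x₃, ∂w₁/∂x₃ − ∂w₃/∂x₁, ∂w₂/∂x₁ − ∂w₁/∂x₂)`. -/
noncomputable def curl3 (w : (Fin 3 → ℝ) → (Fin 3 → ℝ)) (x : Fin 3 → ℝ) : Fin 3 → ℝ :=
  ![pderiv3 1 (fun y => w y 2) x - pderiv3 2 (fun y => w y 1) x,
    pderiv3 2 (fun y => w y 0) x - pderiv3 0 (fun y => w y 2) x,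
    pderiv3 0 (fun y => w y 1) x - pderiv3 1 (fun y => w y 0) x]

/-- The gradient of a function `g : ℝ³ → ℝ`: `∇g = (∂g/∂x₁, ∂g/∂x₂, ∂g/∂x₃)`. -/
noncomputable def grad3 (g : (Fin 3 → ℝ) → ℝ) (x : Fin 3 → ℝ) : Fin 3 → ℝ :=
  fun i => pderiv3 i g x

open MeasureTheory

lemma pderiv3_eq_fderiv (i : Fin 3) {u : (Fin 3 → ℝ) → ℝ} (hu : Differentiable ℝ u)
    (x : Fin 3 → ℝ) : pderiv3 i u x = fderiv ℝ u x (Pi.single i 1) := by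
  have hx : HasFDerivAt u (fderiv ℝ u x) (Function.update x i (x i)) := by
    rw [Function.update_eq_self]
    exact (hu x).hasFDerivAt
  exact (hx.comp_hasDerivAt (x i) (hasDerivAt_update x i (x i))).deriv

section IntegrationByParts

variable {E : Type*} [NormedAddCommGroup E] [NormedSpace ℝ E]
  [MeasurableSpace E] [BorelSpace E] (μ : Measure E)

lemma integrable_fderiv_mul_fderiv [IsFiniteMeasureOnCompacts μ] {g u : E → ℝ} (hg : ContDiff ℝ 1 g)
    (hu : ContDiff ℝ 1 u) (hcg : HasCompactSupport g) (v w : E) :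
    Integrable (fun x => fderiv ℝ g x v * fderiv ℝ u x w) μ :=
  (((hg.continuous_fderiv one_ne_zero).clm_apply continuous_const).mul
    ((hu.continuous_fderiv one_ne_zero).clm_apply continuous_const)).integrable_of_hasCompactSupport
    (hcg.fderiv_apply ℝ v).mul_right

/-- Two directional derivatives may be exchanged between the factors of an integral. -/
lemma integral_fderiv_mul_fderiv_comm [FiniteDimensional ℝ E] [μ.IsAddHaarMeasure]
    {g u : E → ℝ} (hg : ContDiff ℝ 2 g) (hu : ContDiff ℝ 1 u) (hcg : HasCompactSupport g)
    (v w : E) :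
    ∫ x, fderiv ℝ g x v * fderiv ℝ u x w ∂μ = ∫ x, fderiv ℝ g x w * fderiv ℝ u x v ∂μ := by
  have hg' : ContDiff ℝ 1 (fderiv ℝ g) := hg.fderiv_right (by norm_num)
  have hd (a : E) : ContDiff ℝ 1 (fun x => fderiv ℝ g x a) := hg'.clm_apply contDiff_const
  have hc (a : E) : HasCompactSupport (fun x => fderiv ℝ g x a) := hcg.fderiv_apply ℝ a
  have parts (a b : E) : ∫ x, fderiv ℝ g x a * fderiv ℝ u x b ∂μ =
      - ∫ x, fderiv ℝ (fun y => fderiv ℝ g y a) x b * u x ∂μ :=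
    integral_mul_fderiv_eq_neg_fderiv_mul_of_integrable
      ((((hd a).continuous_fderiv_apply one_ne_zero).comp (by fun_prop : Continuous fun x => (x, b))
        |>.mul hu.continuous).integrable_of_hasCompactSupport ((hc a).fderiv_apply ℝ b).mul_right)
      (integrable_fderiv_mul_fderiv μ (hg.of_le (by norm_num)) hu hcg a b)
      (((hd a).continuous.mul hu.continuous).integrable_of_hasCompactSupport (hc a).mul_right)
      (fun x _ => (hd a).differentiable one_ne_zero x)
      (fun x _ => hu.differentiable one_ne_zero x)
  have second (a b x : E) :
      fderiv ℝ (fun y => fderiv ℝ g y a) x b = fderiv ℝ (fderiv ℝ g) x b a := by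
    rw [fderiv_clm_apply (hg'.differentiable one_ne_zero x) (differentiableAt_const a)]
    simp
  rw [parts, parts]
  congr 2 with x
  rw [second, second, (hg.contDiffAt.isSymmSndFDerivAt (by simp)).eq v w]

end IntegrationByParts

/-- if a smooth compactly supported vector field `f` and a smooth
compactly supported function `g` on `ℝ³` satisfy `curl f = ∇g` everywhere, then
`g` is identically zero, and consequently `curl f` is identically zero. -/
theorem curl_eq_grad_imp_zero
    (f : (Fin 3 → ℝ) → (Fin 3 → ℝ)) (g : (Fin 3 → ℝ) → ℝ)
    (hf : ContDiff ℝ (⊤ : ℕ∞) f) (hg : ContDiff ℝ (⊤ : ℕ∞) g)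
    (hcf : HasCompactSupport f) (hcg : HasCompactSupport g)
    (heq : ∀ x : Fin 3 → ℝ, curl3 f x = grad3 g x) :
    (∀ x : Fin 3 → ℝ, g x = 0) ∧ (∀ x : Fin 3 → ℝ, curl3 f x = 0) := by
  have hg2 : ContDiff ℝ 2 g := contDiff_infty.1 hg 2
  have hg1 : ContDiff ℝ 1 g := contDiff_infty.1 hg 1
  have hf1 (k : Fin 3) : ContDiff ℝ 1 (fun y => f y k) :=
    contDiff_pi.1 (contDiff_infty.1 hf 1) k
  have hgp (i : Fin 3) (x : Fin 3 → ℝ) :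
      pderiv3 i g x = fderiv ℝ g x (Pi.single i 1) :=
    pderiv3_eq_fderiv i (hg1.differentiable one_ne_zero) x
  have hint (i j k : Fin 3) :
      Integrable (fun x => pderiv3 i g x * pderiv3 j (fun y => f y k) x) := by
    simp only [hgp, pderiv3_eq_fderiv j ((hf1 k).differentiable one_ne_zero)]
    exact integrable_fderiv_mul_fderiv volume hg1 (hf1 k) hcg _ _
  have hcomm (i j k : Fin 3) :
      ∫ x, pderiv3 i g x * pderiv3 j (fun y => f y k) x =
        ∫ x, pderiv3 j g x * pderiv3 i (fun y => f y k) x := by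
    simp only [hgp, pderiv3_eq_fderiv _ ((hf1 k).differentiable one_ne_zero)]
    exact integral_fderiv_mul_fderiv_comm volume hg2 (hf1 k) hcg _ _
  have hsq (x : Fin 3 → ℝ) : ∑ i, pderiv3 i g x ^ 2 =
      (pderiv3 0 g x * pderiv3 1 (fun y => f y 2) x - pderiv3 1 g x * pderiv3 0 (fun y => f y 2) x)
      + (pderiv3 2 g x * pderiv3 0 (fun y => f y 1) x
        - pderiv3 0 g x * pderiv3 2 (fun y => f y 1) x)
      + (pderiv3 1 g x * pderiv3 2 (fun y => f y 0) x
        - pderiv3 2 g x * pderiv3 1 (fun y => f y 0) x) := by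
    have h0 := congrFun (heq x) 0
    have h1 := congrFun (heq x) 1
    have h2 := congrFun (heq x) 2
    simp only [curl3, grad3, Matrix.cons_val] at h0 h1 h2
    rw [Fin.sum_univ_three]
    linear_combination -pderiv3 0 g x * h0 - pderiv3 1 g x * h1 - pderiv3 2 g x * h2
  have hI (i j k : Fin 3) : Integrable (fun x => pderiv3 i g x * pderiv3 j (fun y => f y k) x -
      pderiv3 j g x * pderiv3 i (fun y => f y k) x) :=
    (hint i j k).sub (hint j i k)
  have hJ (i j k : Fin 3) : ∫ x, (pderiv3 i g x * pderiv3 j (fun y => f y k) x -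
      pderiv3 j g x * pderiv3 i (fun y => f y k) x) = 0 := by
    rw [integral_sub (hint i j k) (hint j i k), hcomm i j k, sub_self]
  have hzero : ∫ x, ∑ i, pderiv3 i g x ^ 2 = 0 := by
    simp only [hsq]
    rw [integral_add ?_ (hI 1 2 0), integral_add (hI 0 1 2) (hI 2 0 1), hJ, hJ, hJ]
    · simp
    · exact (hI 0 1 2).add (hI 2 0 1)
  have hsqint : Integrable (fun x => ∑ i, pderiv3 i g x ^ 2) := by
    simp only [hsq]
    exact ((hI 0 1 2).add (hI 2 0 1)).add (hI 1 2 0)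
  have hsqcont : Continuous (fun x => ∑ i, pderiv3 i g x ^ 2) := by
    simp only [hgp]
    exact continuous_finsetSum _ fun i _ =>
      ((hg1.continuous_fderiv one_ne_zero).clm_apply continuous_const).pow 2
  have hsum : (fun x => ∑ i, pderiv3 i g x ^ 2) = 0 :=
    (hsqcont.ae_eq_iff_eq volume continuous_zero).1 <|
      (integral_eq_zero_iff_of_nonneg
        (fun x => Finset.sum_nonneg fun i _ => sq_nonneg _) hsqint).1 hzero
  have hgrad (i : Fin 3) (x : Fin 3 → ℝ) : pderiv3 i g x = 0 :=
    pow_eq_zero_iff two_ne_zero |>.1 <|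
      (Finset.sum_eq_zero_iff_of_nonneg fun i _ => sq_nonneg _).1 (congrFun hsum x) i
        (Finset.mem_univ i)
  have hfderiv (x : Fin 3 → ℝ) : fderiv ℝ g x = 0 := by
    refine ContinuousLinearMap.coe_injective (LinearMap.pi_ext' fun i => LinearMap.ext_ring ?_)
    simpa using (hgp i x).symm.trans (hgrad i x)
  obtain ⟨x₀, hx₀⟩ := (Set.ne_univ_iff_exists_notMem _).1 hcg.isCompact.ne_univ
  refine ⟨fun x => ?_, fun x => ?_⟩
  · rw [is_const_of_fderiv_eq_zero (hg1.differentiable one_ne_zero) hfderiv x x₀]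
    exact image_eq_zero_of_notMem_tsupport hx₀
  · rw [heq x]
    exact funext fun i => hgrad i x
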